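/- Let A be a real n×n matrix with A = Aᵀ and a_{ii} > 0 for all i, let b ∈ ℝⁿ, and let f(z) = (1/2) zᵀ A z − zᵀ b. Let h > 0, fix i, and let x, x' ∈ ℝⁿ be such that x'_i = (1/(1 + h/2)) · [ −h a_{ii}⁻¹ Σ_{j<i} a_{ij} x'_j + (1 − h/2) x_i − h a_{ii}⁻¹ Σ_{j>i} a_{ij} x_j + h a_{ii}⁻¹ b_i ]. Then f(x'₁,…,x'_i, x_{i+1},…,x_n) − f(x'₁,…,x'_{i−1}, x_i,…,x_n) = −(1/a_{ii}) · (h/(1 + h/2)²) · (Σ_{j<i} a_{ij} x'_j + a_{ii} x_i + Σ_{j>i} a_{ij} x_j − b_i)² ≤ 0. -/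

import Mathlib

open Matrix Finset

/-- Change of a symmetric quadratic energy along a coordinate direction. -/
lemma quadratic_energy_add_single_sub {ι : Type*} [Fintype ι] [DecidableEq ι]
    {A : Matrix ι ι ℝ} (hA : A.IsSymm) (b w : ι → ℝ) (i : ι) (d : ℝ) :
    ((1 / 2) * ((w + Pi.single i d) ⬝ᵥ A.mulVec (w + Pi.single i d)) - (w + Pi.single i d) ⬝ᵥ b)
        - ((1 / 2) * (w ⬝ᵥ A.mulVec w) - w ⬝ᵥ b)
      = d * (A.mulVec w i - b i) + d ^ 2 * A i i / 2 := by
  have hcross : w ⬝ᵥ A.mulVec (Pi.single i d) = d * A.mulVec w i := by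
    rw [dotProduct_mulVec, ← mulVec_transpose, hA.eq, dotProduct_single, mul_comm]
  have hdiag : A.mulVec (Pi.single i d) i = A i i * d := by
    rw [mulVec, dotProduct_single]
  simp only [mulVec_add, add_dotProduct, dotProduct_add, single_dotProduct, hcross, hdiag]
  ring

/-- A sum over a linear order splits into the parts below, at and above a given index. -/
lemma sum_eq_sum_lt_add_add_sum_gt {ι M : Type*} [Fintype ι] [LinearOrder ι] [AddCommMonoid M]
    (g : ι → M) (i : ι) :
    ∑ j, g j = ∑ j ∈ Finset.univ.filter (fun j => j < i), g j + g i
      + ∑ j ∈ Finset.univ.filter (fun j => i < j), g j := by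
  have hle : Finset.univ.filter (fun j => ¬ i < j)
      = insert i (Finset.univ.filter (fun j => j < i)) := by
    ext j
    simp [le_iff_eq_or_lt]
  rw [← Finset.sum_filter_not_add_sum_filter Finset.univ (fun j => i < j) g, hle,
    Finset.sum_insert (by simp), add_comm (g i)]

/-- Componentwise energy dissipation of the Itoh–Abe discrete gradient scheme
(with `P = D⁻¹`): if the `i`-th component is updated by the scheme, the energy
`f(z) = ½ zᵀAz - zᵀb` decreases by
`(1/a_ii) (h/(1+h/2)²) (∑_{j<i} a_ij x'_j + a_ii x_i + ∑_{j>i} a_ij x_j - b_i)²`. -/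
theorem componentwise_energy_dissipation {n : ℕ}
    (A : Matrix (Fin n) (Fin n) ℝ) (hA : A = Aᵀ) (hdiag : ∀ i, 0 < A i i)
    (b : Fin n → ℝ) (f : (Fin n → ℝ) → ℝ)
    (hf : ∀ z, f z = (1 / 2) * (z ⬝ᵥ A.mulVec z) - z ⬝ᵥ b)
    (h : ℝ) (hh : 0 < h) (i : Fin n) (x x' : Fin n → ℝ)
    (hupd : x' i = (1 / (1 + h / 2)) *
      (-(h * (A i i)⁻¹ * ∑ j ∈ Finset.univ.filter (fun j => j < i), A i j * x' j)
        + (1 - h / 2) * x i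
        - h * (A i i)⁻¹ * ∑ j ∈ Finset.univ.filter (fun j => i < j), A i j * x j
        + h * (A i i)⁻¹ * b i)) :
    f (fun j => if j ≤ i then x' j else x j)
        - f (fun j => if j < i then x' j else x j)
      = -(1 / A i i) * (h / (1 + h / 2) ^ 2) *
          ((∑ j ∈ Finset.univ.filter (fun j => j < i), A i j * x' j)
            + A i i * x i
            + (∑ j ∈ Finset.univ.filter (fun j => i < j), A i j * x j)
            - b i) ^ 2 ∧
    f (fun j => if j ≤ i then x' j else x j)
        - f (fun j => if j < i then x' j else x j) ≤ 0 := by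
  have hstep : (fun j => if j ≤ i then x' j else x j)
      = (fun j => if j < i then x' j else x j) + Pi.single i (x' i - x i) := by
    ext j
    rcases lt_trichotomy j i with hj | rfl | hj
    · simp [hj, hj.le, hj.ne]
    · simp
    · simp [hj.not_ge, hj.not_gt, hj.ne']
  have hrow : A.mulVec (fun j => if j < i then x' j else x j) i
      = ∑ j ∈ Finset.univ.filter (fun j => j < i), A i j * x' j + A i i * x i
        + ∑ j ∈ Finset.univ.filter (fun j => i < j), A i j * x j := by
    rw [mulVec, dotProduct, sum_eq_sum_lt_add_add_sum_gt _ i]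
    congr 1
    · congr 1
      · refine Finset.sum_congr rfl fun j hj => ?_
        rw [if_pos (Finset.mem_filter.mp hj).2]
      · simp
    · refine Finset.sum_congr rfl fun j hj => ?_
      rw [if_neg (Finset.mem_filter.mp hj).2.not_gt]
  have ha := hdiag i
  have heq : f (fun j => if j ≤ i then x' j else x j)
        - f (fun j => if j < i then x' j else x j)
      = -(1 / A i i) * (h / (1 + h / 2) ^ 2) *
          ((∑ j ∈ Finset.univ.filter (fun j => j < i), A i j * x' j)
            + A i i * x i
            + (∑ j ∈ Finset.univ.filter (fun j => i < j), A i j * x j)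
            - b i) ^ 2 := by
    rw [hstep, hf, hf, quadratic_energy_add_single_sub hA.symm, hrow]
    generalize ∑ j ∈ Finset.univ.filter (fun j => j < i), A i j * x' j = s at hupd ⊢
    generalize ∑ j ∈ Finset.univ.filter (fun j => i < j), A i j * x j = t at hupd ⊢
    have hd : x' i - x i = -(h * (s + A i i * x i + t - b i)) / (A i i * (1 + h / 2)) := by
      rw [hupd]
      field_simp
      ring
    rw [hd]
    field_simp
    ring
  refine ⟨heq, heq.trans_le ?_⟩
  rw [neg_mul, neg_mul, neg_nonpos]
  positivity
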